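/- arXiv:2403.08491 — 9 statements merged into one kernel-verified Lean document; each statement's English description precedes it below -/
import Mathlib

section
/- Let A be a real m×n matrix and let W₁ (m×m) and W₀ (n×n) be symmetric positive definite matrices. Then there is at most one real n×m matrix X satisfying the four weighted Penrose conditions A·X·A = A, X·A·X = X, (W₁·A·X)ᵀ = W₁·A·X, and (W₀·X·A)ᵀ = W₀·X·A; i.e., if X and X' both satisfy these four equations, then X = X'. (This X is called the weighted Moore–Penrose inverse of A with weights (W₁, W₀).) -/
open Matrix

/-- If `P`, `Q` and `Q * P` are self-adjoint for the symmetric form given by an invertible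
matrix `W`, then `P` and `Q` commute. -/
theorem Matrix.mul_comm_of_weighted_isSymm {n R : Type*} [Fintype n] [DecidableEq n] [CommRing R]
    {W P Q : Matrix n n R} (hW : W.IsSymm) (hW' : IsUnit W)
    (hP : (W * P).IsSymm) (hQ : (W * Q).IsSymm) (hQP : (W * (Q * P)).IsSymm) :
    P * Q = Q * P := by
  have hP' : Pᵀ * W = W * P := by simpa [IsSymm, transpose_mul, hW.eq] using hP
  have hQ' : Qᵀ * W = W * Q := by simpa [IsSymm, transpose_mul, hW.eq] using hQ
  apply hW'.mul_left_cancel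
  calc W * (P * Q) = Pᵀ * Qᵀ * W := by
        rw [← Matrix.mul_assoc, ← hP', Matrix.mul_assoc, ← hQ', Matrix.mul_assoc]
    _ = (W * (Q * P))ᵀ := by simp only [transpose_mul, hW.eq]
    _ = W * (Q * P) := hQP

/-- Uniqueness of the weighted Moore–Penrose inverse: there is at most one matrix `X`
satisfying the four weighted Penrose conditions for `A` with symmetric positive definite
weights `W₁`, `W₀`. -/
theorem weighted_moore_penrose_unique {m n : ℕ}
    (A : Matrix (Fin m) (Fin n) ℝ)
    (W₁ : Matrix (Fin m) (Fin m) ℝ) (W₀ : Matrix (Fin n) (Fin n) ℝ)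
    (hW₁ : W₁.PosDef) (hW₀ : W₀.PosDef)
    (X X' : Matrix (Fin n) (Fin m) ℝ)
    (h1 : A * X * A = A) (h2 : X * A * X = X)
    (h3 : (W₁ * A * X)ᵀ = W₁ * A * X) (h4 : (W₀ * X * A)ᵀ = W₀ * X * A)
    (h1' : A * X' * A = A) (h2' : X' * A * X' = X')
    (h3' : (W₁ * A * X')ᵀ = W₁ * A * X') (h4' : (W₀ * X' * A)ᵀ = W₀ * X' * A) :
    X = X' := by
  have hA : A * X = A * X' := by
    have hQP : A * X' * (A * X) = A * X := by rw [← Matrix.mul_assoc, h1']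
    have hPQ : A * X * (A * X') = A * X' := by rw [← Matrix.mul_assoc, h1]
    rw [Matrix.mul_assoc] at h3 h3'
    have h := mul_comm_of_weighted_isSymm hW₁.isHermitian hW₁.isUnit h3 h3' (by rwa [hQP])
    rw [← hQP, ← h, hPQ]
  have hX : X * A = X' * A := by
    have hQP : X' * A * (X * A) = X' * A := by
      rw [Matrix.mul_assoc, ← Matrix.mul_assoc A, h1]
    have hPQ : X * A * (X' * A) = X * A := by
      rw [Matrix.mul_assoc, ← Matrix.mul_assoc A, h1']
    rw [Matrix.mul_assoc] at h4 h4'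
    have h := mul_comm_of_weighted_isSymm hW₀.isHermitian hW₀.isUnit h4 h4' (by rwa [hQP])
    rw [← hPQ, h, hQP]
  rw [← h2, hX, Matrix.mul_assoc, hA, ← Matrix.mul_assoc, h2']
end

section
/- Let A be a real m×n matrix, W₀ ∈ ℝ^{n×n} symmetric positive definite, R₁ ∈ ℝ^{m×m} invertible, and W₁ := R₁ᵀ·R₁. If G ∈ ℝ^{m×m} satisfies the classical Penrose conditions for B := R₁·A·W₀⁻¹·Aᵀ·R₁ᵀ (i.e., G is the Moore–Penrose inverse of B), then X := W₀⁻¹·Aᵀ·R₁ᵀ·G·R₁ satisfies the weighted Penrose conditions for A with weights (W₁, W₀); that is, the weighted Moore–Penrose inverse of A equals W₀⁻¹·Aᵀ·R₁ᵀ·(R₁·A·W₀⁻¹·Aᵀ·R₁ᵀ)†·R₁. -/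
open Matrix

/-- The Moore–Penrose inverse of a symmetric matrix is symmetric. -/
theorem isSymm_of_penrose {k R : Type*} [Fintype k] [CommRing R] {B G : Matrix k k R}
    (hB : B.IsSymm) (h1 : B * G * B = B) (h2 : G * B * G = G)
    (h3 : (B * G)ᵀ = B * G) (h4 : (G * B)ᵀ = G * B) : G.IsSymm := by
  rw [transpose_mul, hB.eq] at h3 h4
  have hcomm : B * G = G * B := by
    have h1t : B * Gᵀ * B = B := by
      simpa [transpose_mul, hB.eq, Matrix.mul_assoc] using congrArg transpose h1
    calc B * G = B * Gᵀ * B * G := by rw [h1t]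
      _ = G * B * (Gᵀ * B) := by rw [h4, h3, Matrix.mul_assoc, Matrix.mul_assoc]
      _ = G * B := by rw [Matrix.mul_assoc, ← Matrix.mul_assoc B, h1t]
  calc Gᵀ = (G * B * G)ᵀ := by rw [h2]
    _ = Gᵀ * B * Gᵀ := by simp [transpose_mul, hB.eq, Matrix.mul_assoc]
    _ = B * G * Gᵀ := by rw [h3]
    _ = G * (B * Gᵀ) := by rw [hcomm, Matrix.mul_assoc]
    _ = G * (B * G) := by rw [h4, hcomm]
    _ = G := by rw [← Matrix.mul_assoc, h2]

/-- A positive definite congruence `E * V * Eᵀ` vanishes only when `E` does. -/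
theorem Matrix.PosDef.eq_zero_of_mul_mul_transpose_eq_zero {k l : Type*} [Fintype l]
    {V : Matrix l l ℝ} (hV : V.PosDef) {E : Matrix k l ℝ} (h : E * V * Eᵀ = 0) : E = 0 := by
  ext i j
  by_contra hij
  have hne : E i ≠ 0 := fun h0 => hij (congrFun h0 j)
  have hpos := hV.dotProduct_mulVec_pos hne
  have hii : (E * V * Eᵀ) i i = E i ⬝ᵥ V *ᵥ E i := by
    rw [Matrix.mul_assoc, Matrix.mul_apply]
    rfl
  rw [star_trivial, ← hii, h] at hpos
  exact lt_irrefl _ hpos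

/-- Weighted generalization of `A† = Aᵀ(AAᵀ)†`: if `G` is the Moore–Penrose inverse of
`B = R₁·A·W₀⁻¹·Aᵀ·R₁ᵀ`, then `X = W₀⁻¹·Aᵀ·R₁ᵀ·G·R₁` satisfies the weighted Penrose
conditions for `A` with weights `(W₁, W₀)`, where `W₁ = R₁ᵀ·R₁`. -/
theorem weighted_penrose_via_gram {m n : ℕ}
    (A : Matrix (Fin m) (Fin n) ℝ)
    (W₀ : Matrix (Fin n) (Fin n) ℝ) (hW₀ : W₀.PosDef)
    (R₁ : Matrix (Fin m) (Fin m) ℝ) (hR₁ : IsUnit R₁)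
    (W₁ : Matrix (Fin m) (Fin m) ℝ) (hW₁ : W₁ = R₁ᵀ * R₁)
    (B : Matrix (Fin m) (Fin m) ℝ) (hB : B = R₁ * A * W₀⁻¹ * Aᵀ * R₁ᵀ)
    (G : Matrix (Fin m) (Fin m) ℝ)
    (hG1 : B * G * B = B) (hG2 : G * B * G = G)
    (hG3 : (B * G)ᵀ = B * G) (hG4 : (G * B)ᵀ = G * B)
    (X : Matrix (Fin n) (Fin m) ℝ) (hX : X = W₀⁻¹ * Aᵀ * R₁ᵀ * G * R₁) :
    A * X * A = A ∧ X * A * X = X ∧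
      (W₁ * A * X)ᵀ = W₁ * A * X ∧ (W₀ * X * A)ᵀ = W₀ * X * A := by
  obtain ⟨C, hC⟩ : ∃ C, C = R₁ * A := ⟨_, rfl⟩
  obtain ⟨V, hV⟩ : ∃ V, V = W₀⁻¹ := ⟨_, rfl⟩
  have hVpos : V.PosDef := hV ▸ hW₀.inv
  have hVsymm : Vᵀ = V := by simpa using hVpos.isHermitian.eq
  have hWV : W₀ * V = 1 := by
    rw [hV, Matrix.mul_nonsing_inv _ ((Matrix.isUnit_iff_isUnit_det _).1 hW₀.isUnit)]
  have hBC : B = C * V * Cᵀ := by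
    rw [hB, hC, hV, transpose_mul]
    simp only [Matrix.mul_assoc]
  have hXC : X = V * Cᵀ * G * R₁ := by
    rw [hX, hC, hV, transpose_mul]
    simp only [Matrix.mul_assoc]
  have hBsymm : Bᵀ = B := by
    simp [hBC, transpose_mul, hVsymm, Matrix.mul_assoc]
  have hGsymm : Gᵀ = G := isSymm_of_penrose hBsymm hG1 hG2 hG3 hG4
  have hCAX : R₁ * (A * X) = B * G * R₁ := by
    rw [← Matrix.mul_assoc, ← hC, hXC, hBC]
    simp only [Matrix.mul_assoc]
  have hBGC : B * G * C = C := by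
    refine sub_eq_zero.1 (hVpos.eq_zero_of_mul_mul_transpose_eq_zero ?_)
    have hE : (B * G * C - C) * V * Cᵀ = 0 := by
      calc (B * G * C - C) * V * Cᵀ = B * G * (C * V * Cᵀ) - C * V * Cᵀ := by
            simp only [Matrix.sub_mul, Matrix.mul_assoc]
        _ = 0 := by rw [← hBC, hG1, sub_self]
    rw [transpose_sub, transpose_mul, Matrix.mul_sub, ← Matrix.mul_assoc, hE,
      Matrix.zero_mul, sub_zero]
  refine ⟨?_, ?_, ?_, ?_⟩
  · have hR : R₁ * (A * X * A) = R₁ * A := by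
      rw [← Matrix.mul_assoc, hCAX, Matrix.mul_assoc, ← hC, hBGC]
    have hdet := (Matrix.isUnit_iff_isUnit_det _).1 hR₁
    rw [← Matrix.nonsing_inv_mul_cancel_left R₁ (A * X * A) hdet, hR,
      Matrix.nonsing_inv_mul_cancel_left R₁ A hdet]
  · calc X * A * X = V * Cᵀ * G * (R₁ * (A * X)) := by
          rw [Matrix.mul_assoc X]
          nth_rw 1 [hXC]
          simp only [Matrix.mul_assoc]
      _ = V * Cᵀ * (G * B * G) * R₁ := by
          rw [hCAX]
          simp only [Matrix.mul_assoc]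
      _ = X := by rw [hG2, hXC]
  · have hW : W₁ * A * X = R₁ᵀ * (B * G) * R₁ := by
      rw [hW₁, Matrix.mul_assoc, Matrix.mul_assoc, hCAX]
      simp only [Matrix.mul_assoc]
    rw [hW, transpose_mul, transpose_mul, hG3, transpose_transpose, ← Matrix.mul_assoc]
  · have hW : W₀ * X * A = Cᵀ * G * C := by
      calc W₀ * X * A = W₀ * V * (Cᵀ * G * (R₁ * A)) := by
            rw [hXC]
            simp only [Matrix.mul_assoc]
        _ = Cᵀ * G * C := by rw [hWV, Matrix.one_mul, hC]
    rw [hW, transpose_mul, transpose_mul, hGsymm, transpose_transpose, Matrix.mul_assoc]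
end

section
/- Let M ∈ ℝ^{n×n} be symmetric positive definite, and for k = 1,…,r let Aₖ ∈ ℝ^{mₖ×n}, let Wₖ ∈ ℝ^{mₖ×mₖ} be symmetric positive definite, and let Xₖ ∈ ℝ^{n×mₖ} satisfy the weighted Penrose conditions for Aₖ with weights (Wₖ, M). Assume the mutual annihilation property Aⱼ·Xₖ = 0 for all j ≠ k. Then the vertically stacked matrix A ∈ ℝ^{m×n} (whose row blocks are A₁,…,A_r, with m = m₁+…+m_r) and the horizontally stacked matrix X := [X₁ … X_r] ∈ ℝ^{n×m} satisfy the weighted Penrose conditions for A with weights (W, M), where W is the block-diagonal matrix with diagonal blocks W₁,…,W_r; i.e., X is the weighted Moore–Penrose inverse of the stack A. -/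
open Matrix

section BlockStack

variable {o l R : Type*} {m : o → Type*} [Fintype o] [DecidableEq o] [∀ k, Fintype (m k)]

theorem blockDiagonal'_mul_apply_sigma [NonUnitalNonAssocSemiring R]
    (D : ∀ k, Matrix (m k) (m k) R) (S : Matrix ((k : o) × m k) l R) (k : o) (i : m k) (j : l) :
    (Matrix.blockDiagonal' D * S) ⟨k, i⟩ j = ∑ a, D k i a * S ⟨k, a⟩ j := by
  rw [Matrix.mul_apply, Fintype.sum_sigma, Fintype.sum_eq_single k]
  · simp only [Matrix.blockDiagonal'_apply_eq]
  · intro k' hk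
    exact Finset.sum_eq_zero fun a _ => by
      rw [Matrix.blockDiagonal'_apply_ne _ _ _ hk.symm, zero_mul]

theorem mul_blockDiagonal'_apply_sigma [NonUnitalNonAssocSemiring R]
    (D : ∀ k, Matrix (m k) (m k) R) (S : Matrix l ((k : o) × m k) R) (i : l) (k : o) (j : m k) :
    (S * Matrix.blockDiagonal' D) i ⟨k, j⟩ = ∑ a, S i ⟨k, a⟩ * D k a j := by
  rw [Matrix.mul_apply, Fintype.sum_sigma, Fintype.sum_eq_single k]
  · simp only [Matrix.blockDiagonal'_apply_eq]
  · intro k' hk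
    exact Finset.sum_eq_zero fun a _ => by
      rw [Matrix.blockDiagonal'_apply_ne _ _ _ hk, mul_zero]

end BlockStack

/-- If each `Xₖ` is the weighted Moore–Penrose inverse of `Aₖ` with weights `(Wₖ, M)` and
the mutual annihilation `Aⱼ · Xₖ = 0` holds for `j ≠ k`, then the horizontal stack
`X = [X₁ … X_r]` satisfies the weighted Penrose conditions for the vertical stack `A`
with weights `(W, M)`, `W` block-diagonal with blocks `Wₖ`. -/
theorem stacked_weighted_penrose {r n : ℕ} (md : Fin r → ℕ)
    (M : Matrix (Fin n) (Fin n) ℝ) (hM : M.PosDef)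
    (A : ∀ k : Fin r, Matrix (Fin (md k)) (Fin n) ℝ)
    (W : ∀ k : Fin r, Matrix (Fin (md k)) (Fin (md k)) ℝ)
    (hW : ∀ k, (W k).PosDef)
    (X : ∀ k : Fin r, Matrix (Fin n) (Fin (md k)) ℝ)
    (h1 : ∀ k, A k * X k * A k = A k)
    (h2 : ∀ k, X k * A k * X k = X k)
    (h3 : ∀ k, (W k * (A k * X k))ᵀ = W k * (A k * X k))
    (h4 : ∀ k, (M * (X k * A k))ᵀ = M * (X k * A k))
    (hannihil : ∀ j k : Fin r, j ≠ k → A j * X k = 0)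
    (SA : Matrix ((k : Fin r) × Fin (md k)) (Fin n) ℝ)
    (SX : Matrix (Fin n) ((k : Fin r) × Fin (md k)) ℝ)
    (SW : Matrix ((k : Fin r) × Fin (md k)) ((k : Fin r) × Fin (md k)) ℝ)
    (hSA : ∀ (k : Fin r) (i : Fin (md k)) (j : Fin n), SA ⟨k, i⟩ j = A k i j)
    (hSX : ∀ (i : Fin n) (k : Fin r) (j : Fin (md k)), SX i ⟨k, j⟩ = X k i j)
    (hSW : SW = Matrix.blockDiagonal' W) :
    SA * SX * SA = SA ∧ SX * SA * SX = SX ∧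
      (SW * SA * SX)ᵀ = SW * SA * SX ∧ (M * SX * SA)ᵀ = M * SX * SA := by
  have hAX : SA * SX = Matrix.blockDiagonal' fun k => A k * X k := by
    ext ⟨j, a⟩ ⟨k, b⟩
    have hentry : (SA * SX) ⟨j, a⟩ ⟨k, b⟩ = (A j * X k) a b := by
      simp only [Matrix.mul_apply, hSA, hSX]
    rw [hentry]
    by_cases hjk : j = k
    · subst hjk
      rw [Matrix.blockDiagonal'_apply_eq]
    · rw [hannihil j k hjk, Matrix.blockDiagonal'_apply_ne _ _ _ hjk, Matrix.zero_apply]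
  have hXA : SX * SA = ∑ k, X k * A k := by
    ext i j
    rw [Matrix.mul_apply, Fintype.sum_sigma, Matrix.sum_apply]
    simp only [Matrix.mul_apply, hSA, hSX]
  refine ⟨?_, ?_, ?_, ?_⟩
  · ext ⟨k, i⟩ j
    rw [hAX, blockDiagonal'_mul_apply_sigma]
    simp only [hSA]
    rw [← Matrix.mul_apply, h1]
  · ext i ⟨k, j⟩
    rw [Matrix.mul_assoc, hAX, mul_blockDiagonal'_apply_sigma]
    simp only [hSX]
    rw [← Matrix.mul_apply, ← Matrix.mul_assoc, h2]
  · rw [Matrix.mul_assoc, hAX, hSW, ← Matrix.blockDiagonal'_mul, Matrix.blockDiagonal'_transpose]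
    simp only [h3]
  · rw [Matrix.mul_assoc, hXA, Matrix.mul_sum, Matrix.transpose_sum]
    simp only [h4]
end

section
/- Let M ∈ ℝ^{n×n} be symmetric positive definite, let Z ∈ ℝ^{n×p} satisfy Zᵀ·M·Z = 1ₚ, let R ∈ ℝ^{m×m} be invertible with W := Rᵀ·R, and let A ∈ ℝ^{m×n}. Set Â := R·A·Z and let X̂ ∈ ℝ^{p×m} satisfy the classical Penrose conditions for Â. Then the matrix Ā⁺ := Z·X̂·R satisfies the weighted Penrose conditions for the projected matrix Ā := A·Z·Zᵀ·M with weights (W, M); i.e., the weighted Moore–Penrose inverse of Ā = A·P, where P := Z·Zᵀ·M, is given by Z·Â†·R. -/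
open Matrix

/-- If `Xh` is the Moore–Penrose inverse of `Ah = R·A·Z` (with `Zᵀ·M·Z = 1`, `W = Rᵀ·R`),
then `Abarplus = Z·Xh·R` satisfies the weighted Penrose conditions for the projected
matrix `Abar = A·Z·Zᵀ·M` with weights `(W, M)`. -/
theorem projected_weighted_penrose {m n p : ℕ}
    (M : Matrix (Fin n) (Fin n) ℝ) (hM : M.PosDef)
    (Z : Matrix (Fin n) (Fin p) ℝ) (hZ : Zᵀ * M * Z = 1)
    (R : Matrix (Fin m) (Fin m) ℝ) (hR : IsUnit R)
    (W : Matrix (Fin m) (Fin m) ℝ) (hW : W = Rᵀ * R)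
    (A : Matrix (Fin m) (Fin n) ℝ)
    (Ah : Matrix (Fin m) (Fin p) ℝ) (hAh : Ah = R * A * Z)
    (Xh : Matrix (Fin p) (Fin m) ℝ)
    (hh1 : Ah * Xh * Ah = Ah) (hh2 : Xh * Ah * Xh = Xh)
    (hh3 : (Ah * Xh)ᵀ = Ah * Xh) (hh4 : (Xh * Ah)ᵀ = Xh * Ah)
    (Abar : Matrix (Fin m) (Fin n) ℝ) (hAbar : Abar = A * (Z * Zᵀ * M))
    (Abarplus : Matrix (Fin n) (Fin m) ℝ) (hAbarplus : Abarplus = Z * Xh * R) :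
    Abar * Abarplus * Abar = Abar ∧ Abarplus * Abar * Abarplus = Abarplus ∧
      (W * Abar * Abarplus)ᵀ = W * Abar * Abarplus ∧
      (M * Abarplus * Abar)ᵀ = M * Abarplus * Abar := by
  have hMt : Mᵀ = M := by
    simpa only [conjTranspose_eq_transpose_of_trivial] using hM.isHermitian.eq
  have hleft : Abar * Abarplus = A * Z * Xh * R := by
    calc Abar * Abarplus = A * Z * (Zᵀ * M * Z) * Xh * R := by
          simp only [hAbar, hAbarplus, Matrix.mul_assoc]
      _ = A * Z * Xh * R := by rw [hZ, Matrix.mul_one]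
  have hright : Abarplus * Abar = Z * (Xh * Ah) * Zᵀ * M := by
    simp only [hAbar, hAbarplus, hAh, Matrix.mul_assoc]
  have hAZ : A * Z * Xh * R * (A * Z) = A * Z := by
    obtain ⟨S, hS⟩ := hR.exists_left_inv
    calc A * Z * Xh * R * (A * Z) = S * R * (A * Z * Xh * R * (A * Z)) := by
          rw [hS, Matrix.one_mul]
      _ = S * (Ah * Xh * Ah) := by simp only [hAh, Matrix.mul_assoc]
      _ = S * R * (A * Z) := by
          rw [hh1, hAh]
          simp only [Matrix.mul_assoc]
      _ = A * Z := by rw [hS, Matrix.one_mul]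
  refine ⟨?_, ?_, ?_, ?_⟩
  · calc Abar * Abarplus * Abar = A * Z * Xh * R * (A * Z) * (Zᵀ * M) := by
          rw [hleft, hAbar]
          simp only [Matrix.mul_assoc]
      _ = Abar := by
          rw [hAZ, hAbar]
          simp only [Matrix.mul_assoc]
  · calc Abarplus * Abar * Abarplus = Z * (Xh * Ah * Xh) * R := by
          rw [Matrix.mul_assoc, hleft, hAbarplus, hAh]
          simp only [Matrix.mul_assoc]
      _ = Abarplus := by rw [hh2, hAbarplus]
  · have h : W * Abar * Abarplus = Rᵀ * (Ah * Xh) * R := by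
      rw [Matrix.mul_assoc, hleft, hW, hAh]
      simp only [Matrix.mul_assoc]
    rw [h, transpose_mul, transpose_mul, hh3, transpose_transpose, ← Matrix.mul_assoc]
  · have h : M * Abarplus * Abar = M * Z * (Xh * Ah) * (Zᵀ * M) := by
      rw [Matrix.mul_assoc, hright]
      simp only [Matrix.mul_assoc]
    rw [h, transpose_mul, transpose_mul (M * Z), hh4, transpose_mul, transpose_mul, hMt,
      transpose_transpose]
    simp only [Matrix.mul_assoc]
end

section
/- Let M ∈ ℝ^{n×n} be symmetric positive definite and Z ∈ ℝ^{n×p} with Zᵀ·M·Z = 1ₚ. Let Â ∈ ℝ^{m×p} have a compact complete orthogonal decomposition Â = U·L·Yᵀ with Uᵀ·U = 1ᵨ, Yᵀ·Y = 1ᵨ, L ∈ ℝ^{ρ×ρ} invertible, and let Z̃ ∈ ℝ^{p×(p−ρ)} satisfy Z̃ᵀ·Z̃ = 1 and Y·Yᵀ + Z̃·Z̃ᵀ = 1ₚ. Let R ∈ ℝ^{m×m} be invertible, A ∈ ℝ^{m×n} be such that Â = R·A·Z, and define P := Z·Zᵀ·M, Ā := A·P, Ā⁺ := Z·Y·L⁻¹·Uᵀ·R,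 and Z' := Z·Z̃. Then the updated projector satisfies P·(1ₙ − Ā⁺·Ā) = Z'·Z'ᵀ·M, and (Z')ᵀ·M·Z' = 1_{p−ρ}. -/
open Matrix

/-- Induction step of the projected-stack construction: with `P = Z·Zᵀ·M`,
`Abar = A·P`, `Abarplus = Z·Y·L⁻¹·Uᵀ·R` built from the compact COD
`Ah = R·A·Z = U·L·Yᵀ` and `Zt` completing `Y` (`Y·Yᵀ + Zt·Ztᵀ = 1`), the next
projector satisfies `P·(1 − Abarplus·Abar) = Z'·Z'ᵀ·M` with `Z' = Z·Zt`, and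
`Z'ᵀ·M·Z' = 1`. -/
theorem projector_update {m n p ρ s : ℕ}
    (M : Matrix (Fin n) (Fin n) ℝ) (hM : M.PosDef)
    (Z : Matrix (Fin n) (Fin p) ℝ) (hZ : Zᵀ * M * Z = 1)
    (Ah : Matrix (Fin m) (Fin p) ℝ)
    (U : Matrix (Fin m) (Fin ρ) ℝ) (L : Matrix (Fin ρ) (Fin ρ) ℝ)
    (Y : Matrix (Fin p) (Fin ρ) ℝ)
    (hU : Uᵀ * U = 1) (hY : Yᵀ * Y = 1) (hL : IsUnit L)
    (hCOD : Ah = U * L * Yᵀ)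
    (Zt : Matrix (Fin p) (Fin s) ℝ)
    (hZt : Ztᵀ * Zt = 1) (hcompl : Y * Yᵀ + Zt * Ztᵀ = 1)
    (R : Matrix (Fin m) (Fin m) ℝ) (hR : IsUnit R)
    (A : Matrix (Fin m) (Fin n) ℝ) (hAh : Ah = R * A * Z)
    (P : Matrix (Fin n) (Fin n) ℝ) (hP : P = Z * Zᵀ * M)
    (Abar : Matrix (Fin m) (Fin n) ℝ) (hAbar : Abar = A * P)
    (Abarplus : Matrix (Fin n) (Fin m) ℝ)
    (hAbarplus : Abarplus = Z * Y * L⁻¹ * Uᵀ * R)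
    (Z' : Matrix (Fin n) (Fin s) ℝ) (hZ' : Z' = Z * Zt) :
    P * (1 - Abarplus * Abar) = Z' * Z'ᵀ * M ∧ Z'ᵀ * M * Z' = 1 := by
  have hRAZ : R * A * Z = U * L * Yᵀ := hAh.symm.trans hCOD
  have hLL : L⁻¹ * L = 1 := nonsing_inv_mul L ((isUnit_iff_isUnit_det L).mp hL)
  subst hP hAbar hAbarplus hZ'
  constructor
  · have hproj : Z * Zᵀ * M * (Z * Y * L⁻¹ * Uᵀ * R * (A * (Z * Zᵀ * M))) =
        Z * (Y * Yᵀ) * Zᵀ * M :=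
      calc
        _ = Z * (Zᵀ * M * Z) * Y * L⁻¹ * Uᵀ * (R * A * Z) * Zᵀ * M := by
          simp only [Matrix.mul_assoc]
        _ = Z * Y * L⁻¹ * (Uᵀ * U) * L * Yᵀ * Zᵀ * M := by
          rw [hZ, hRAZ, Matrix.mul_one]
          simp only [Matrix.mul_assoc]
        _ = Z * Y * (L⁻¹ * L) * Yᵀ * Zᵀ * M := by
          rw [hU, Matrix.mul_one]
          simp only [Matrix.mul_assoc]
        _ = _ := by
          rw [hLL, Matrix.mul_one]
          simp only [Matrix.mul_assoc]
    calc
      _ = Z * (1 - Y * Yᵀ) * Zᵀ * M := by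
        rw [Matrix.mul_sub, hproj, Matrix.mul_one, Matrix.mul_sub, Matrix.mul_one,
          Matrix.sub_mul, Matrix.sub_mul]
      _ = Z * (Zt * Ztᵀ) * Zᵀ * M := by rw [← hcompl, add_sub_cancel_left]
      _ = _ := by simp only [transpose_mul, Matrix.mul_assoc]
  · calc
      _ = Ztᵀ * (Zᵀ * M * Z) * Zt := by simp only [transpose_mul, Matrix.mul_assoc]
      _ = 1 := by rw [hZ, Matrix.mul_one, hZt]
end

section
/- Let M ∈ ℝ^{n×n} be symmetric positive definite. Let Z₀ ∈ ℝ^{n×p₀} satisfy Z₀ᵀ·M·Z₀ = 1, and for k = 1,…,r let Z̃ₖ ∈ ℝ^{p_{k−1}×pₖ} with Z̃ₖᵀ·Z̃ₖ = 1, let Yₖ ∈ ℝ^{p_{k−1}×ρₖ} with Yₖᵀ·Yₖ = 1 and Yₖᵀ·Z̃ₖ = 0, and define recursively Zₖ := Z_{k−1}·Z̃ₖ. Then the block columns Gₖ := Z_{k−1}·Yₖ of the coordinate transformation are mutually M-orthonormal: Gₖᵀ·M·Gₖ = 1 for every k, and Gⱼᵀ·M·Gₖ = 0 whenever j < k. Consequently,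 the matrix F⁻¹ whose column blocks are G₁,…,G_r satisfies (F⁻¹)ᵀ·M·F⁻¹ = block-diagonal identity, i.e., the transformed inertia matrix is the identity. -/
open Matrix

/-- Congruence of `M` by products `A * B` and `A * C`, where the columns of `A` are
`M`-orthonormal. -/
lemma transpose_mul_mul_of_orthonormal {m p q s : Type*} [Fintype m] [Fintype p]
    [DecidableEq p] {M : Matrix m m ℝ} {A : Matrix m p ℝ} (hA : Aᵀ * M * A = 1)
    (B : Matrix p q ℝ) (C : Matrix p s ℝ) : (A * B)ᵀ * M * (A * C) = Bᵀ * C := by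
  calc (A * B)ᵀ * M * (A * C) = Bᵀ * (Aᵀ * M * A) * C := by
        simp only [transpose_mul, Matrix.mul_assoc]
    _ = Bᵀ * C := by rw [hA, Matrix.mul_one]

/-- A matrix split into column blocks that are mutually `M`-orthonormal has `M`-orthonormal
columns. -/
lemma transpose_mul_mul_eq_one_of_blocks {m ι : Type*} [Fintype m] [DecidableEq ι]
    {κ : ι → Type*} [∀ i, DecidableEq (κ i)] {M : Matrix m m ℝ}
    {F : Matrix m ((i : ι) × κ i) ℝ} {G : ∀ i, Matrix m (κ i) ℝ}
    (hF : ∀ i a x, F x ⟨i, a⟩ = G i x a)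
    (hdiag : ∀ i, (G i)ᵀ * M * G i = 1)
    (hoff : ∀ i j, i ≠ j → (G i)ᵀ * M * G j = 0) : Fᵀ * M * F = 1 := by
  ext ⟨i, a⟩ ⟨j, b⟩
  have hentry : (Fᵀ * M * F) ⟨i, a⟩ ⟨j, b⟩ = ((G i)ᵀ * M * G j) a b := by
    simp only [mul_apply, transpose_apply, hF]
  rw [hentry]
  by_cases hij : i = j
  · subst hij
    rw [hdiag]
    simp [one_apply]
  · rw [hoff i j hij, one_apply_ne fun h => hij (congrArg Sigma.fst h)]
    rfl

/-- The block columns `Gₖ = Z_{k−1}·Yₖ` of the coordinate transformation are mutually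
`M`-orthonormal, and consequently the transformed inertia matrix `(F⁻¹)ᵀ·M·F⁻¹` is the
(block-diagonal) identity. Here `Zₖ = Z_{k−1}·Z̃ₖ` with `Z₀ᵀ·M·Z₀ = 1`,
`Z̃ₖᵀ·Z̃ₖ = 1`, `Yₖᵀ·Yₖ = 1`, `Yₖᵀ·Z̃ₖ = 0`. -/
theorem inertia_decoupling {n r : ℕ} (p ρ : ℕ → ℕ)
    (M : Matrix (Fin n) (Fin n) ℝ) (hM : M.PosDef)
    (Z : ∀ k : ℕ, Matrix (Fin n) (Fin (p k)) ℝ)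
    (Zt : ∀ k : ℕ, Matrix (Fin (p k)) (Fin (p (k + 1))) ℝ)
    (Y : ∀ k : ℕ, Matrix (Fin (p k)) (Fin (ρ k)) ℝ)
    (hZ0 : (Z 0)ᵀ * M * Z 0 = 1)
    (hZt : ∀ k, k < r → (Zt k)ᵀ * Zt k = 1)
    (hY : ∀ k, k < r → (Y k)ᵀ * Y k = 1)
    (hYZt : ∀ k, k < r → (Y k)ᵀ * Zt k = 0)
    (hrec : ∀ k, k < r → Z (k + 1) = Z k * Zt k)
    (G : ∀ k : ℕ, Matrix (Fin n) (Fin (ρ k)) ℝ)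
    (hG : ∀ k, k < r → G k = Z k * Y k)
    (Finv : Matrix (Fin n) ((k : Fin r) × Fin (ρ k)) ℝ)
    (hFinv : ∀ (k : Fin r) (a : Fin (ρ k)) (i : Fin n), Finv i ⟨k, a⟩ = G k i a) :
    (∀ k, k < r → (G k)ᵀ * M * G k = 1) ∧
      (∀ j k, j < k → k < r → (G j)ᵀ * M * G k = 0) ∧
      Finvᵀ * M * Finv = 1 := by
  have hZ : ∀ k, k ≤ r → (Z k)ᵀ * M * Z k = 1 := by
    intro k
    induction k with
    | zero => exact fun _ => hZ0
    | succ k ih =>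
      intro hk
      rw [hrec k hk, transpose_mul_mul_of_orthonormal (ih (by omega)), hZt k hk]
  have hGZ : ∀ j k, j < k → k ≤ r → (G j)ᵀ * M * Z k = 0 := by
    intro j k hjk
    induction k, hjk using Nat.le_induction with
    | base =>
      intro hj
      rw [hG j hj, hrec j hj, transpose_mul_mul_of_orthonormal (hZ j (by omega)), hYZt j hj]
    | succ k _ ih =>
      intro hk
      rw [hrec k hk, ← Matrix.mul_assoc, ih (by omega), Matrix.zero_mul]
  have hdiag : ∀ k, k < r → (G k)ᵀ * M * G k = 1 := by
    intro k hk
    rw [hG k hk, transpose_mul_mul_of_orthonormal (hZ k hk.le), hY k hk]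
  have hoff : ∀ j k, j < k → k < r → (G j)ᵀ * M * G k = 0 := by
    intro j k hjk hk
    rw [hG k hk, ← Matrix.mul_assoc, hGZ j k hjk hk.le, Matrix.zero_mul]
  have hMt : Mᵀ = M := by
    simpa [conjTranspose_eq_transpose_of_trivial] using hM.isHermitian.eq
  refine ⟨hdiag, hoff, transpose_mul_mul_eq_one_of_blocks (G := fun k : Fin r => G k) hFinv
    (fun k => hdiag k k.isLt) fun j k hjk => ?_⟩
  rcases lt_or_gt_of_ne hjk with h | h
  · exact hoff j k h k.isLt
  · have := congrArg transpose (hoff k j h j.isLt)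
    simpa [transpose_mul, hMt, Matrix.mul_assoc] using this
end

section
/- Let M, C, G : ℝ → ℝ^{n×n} be matrix-valued functions of time such that M and G are differentiable, M(t) is symmetric for every t, the derivative of M satisfies M'(t) = C(t) + C(t)ᵀ for every t, and G(t)ᵀ·M(t)·G(t) = 1ₙ for every t. Then the transformed Coriolis matrix Γ(t) := G(t)ᵀ·(C(t)·G(t) + M(t)·G'(t)) is skew-symmetric for every t, i.e., Γ(t) + Γ(t)ᵀ = 0. -/
open Matrix

/-- The product rule for matrix-valued functions of a real variable, entrywise. -/
theorem hasDerivAt_matrix_mul_apply {l m n : Type*} [Fintype m]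
    {A : ℝ → Matrix l m ℝ} {B : ℝ → Matrix m n ℝ} {A' : Matrix l m ℝ} {B' : Matrix m n ℝ} {t : ℝ}
    (hA : ∀ i j, HasDerivAt (fun s => A s i j) (A' i j) t)
    (hB : ∀ i j, HasDerivAt (fun s => B s i j) (B' i j) t) (i : l) (j : n) :
    HasDerivAt (fun s => (A s * B s) i j) ((A' * B t + A t * B') i j) t := by
  simp only [Matrix.add_apply, Matrix.mul_apply, ← Finset.sum_add_distrib]
  exact HasDerivAt.fun_sum fun k _ => (hA i k).fun_mul (hB k j)

/-- If `M` is symmetric with `Ṁ = C + Cᵀ` (passivity) and `Gᵀ·M·G ≡ 1` (inertial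
decoupling), then the transformed Coriolis matrix `Γ = Gᵀ·(C·G + M·Ġ)` is
skew-symmetric: `Γ + Γᵀ = 0`. Derivatives are taken entrywise. -/
theorem transformed_coriolis_skew {n : ℕ}
    (M C G M' G' : ℝ → Matrix (Fin n) (Fin n) ℝ)
    (hM : ∀ (t : ℝ) (i j : Fin n), HasDerivAt (fun s => M s i j) (M' t i j) t)
    (hG : ∀ (t : ℝ) (i j : Fin n), HasDerivAt (fun s => G s i j) (G' t i j) t)
    (hMsymm : ∀ t, (M t)ᵀ = M t)
    (hpass : ∀ t, M' t = C t + (C t)ᵀ)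
    (hGMG : ∀ t, (G t)ᵀ * M t * G t = 1)
    (Γ : ℝ → Matrix (Fin n) (Fin n) ℝ)
    (hΓ : ∀ t, Γ t = (G t)ᵀ * (C t * G t + M t * G' t)) :
    ∀ t, Γ t + (Γ t)ᵀ = 0 := by
  intro t
  have hD : ((G' t)ᵀ * M t + (G t)ᵀ * M' t) * G t + (G t)ᵀ * M t * G' t = 0 := by
    ext i j
    have h := hasDerivAt_matrix_mul_apply
      (hasDerivAt_matrix_mul_apply (A := fun s => (G s)ᵀ) (A' := (G' t)ᵀ)
        (fun i j => hG t j i) (hM t)) (hG t) i j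
    simp only [hGMG] at h
    exact h.unique (hasDerivAt_const t _)
  rw [hpass] at hD
  rw [hΓ, ← hD]
  simp only [transpose_mul, transpose_add, transpose_transpose, hMsymm]
  noncomm_ring
end

section
/- Let M ∈ ℝ^{n×n} be symmetric positive definite, Z ∈ ℝ^{n×p} with Zᵀ·M·Z = 1ₚ, R ∈ ℝ^{m×m} invertible, A ∈ ℝ^{m×n}, Â := R·A·Z, and let X̂ satisfy the classical Penrose conditions for Â. Define P := Z·Zᵀ·M, Ā := A·P, and Ā⁺ := Z·X̂·R. Then A·Ā⁺ = Ā·Ā⁺, and consequently, for any x₀ ∈ ℝⁿ and b ∈ ℝᵐ, setting v := b − A·x₀, x₁ := x₀ + Ā⁺·v, and w := −(1ₘ − Ā·Ā⁺)·v, the primal feasibility A·x₁ = b + w of the relaxed task constraint holds. -/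
open Matrix

/-- With `Ah = R·A·Z`, `Xh` the Moore–Penrose inverse of `Ah`, `P = Z·Zᵀ·M`,
`Abar = A·P` and `Abarplus = Z·Xh·R`, one has `A·Abarplus = Abar·Abarplus`;
consequently, for `v = b − A·x₀`, `x₁ = x₀ + Abarplus·v` and
`w = −(1 − Abar·Abarplus)·v`, primal feasibility `A·x₁ = b + w` holds. -/
theorem primal_feasibility {m n p : ℕ}
    (M : Matrix (Fin n) (Fin n) ℝ) (hM : M.PosDef)
    (Z : Matrix (Fin n) (Fin p) ℝ) (hZ : Zᵀ * M * Z = 1)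
    (R : Matrix (Fin m) (Fin m) ℝ) (hR : IsUnit R)
    (A : Matrix (Fin m) (Fin n) ℝ)
    (Ah : Matrix (Fin m) (Fin p) ℝ) (hAh : Ah = R * A * Z)
    (Xh : Matrix (Fin p) (Fin m) ℝ)
    (hh1 : Ah * Xh * Ah = Ah) (hh2 : Xh * Ah * Xh = Xh)
    (hh3 : (Ah * Xh)ᵀ = Ah * Xh) (hh4 : (Xh * Ah)ᵀ = Xh * Ah)
    (P : Matrix (Fin n) (Fin n) ℝ) (hP : P = Z * Zᵀ * M)
    (Abar : Matrix (Fin m) (Fin n) ℝ) (hAbar : Abar = A * P)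
    (Abarplus : Matrix (Fin n) (Fin m) ℝ) (hAbarplus : Abarplus = Z * Xh * R) :
    A * Abarplus = Abar * Abarplus ∧
      ∀ (x₀ : Fin n → ℝ) (b : Fin m → ℝ),
        A.mulVec (x₀ + Abarplus.mulVec (b - A.mulVec x₀)) =
          b + (-(1 - Abar * Abarplus).mulVec (b - A.mulVec x₀)) := by
  have hPZ : P * Z = Z := by
    rw [hP, Matrix.mul_assoc, Matrix.mul_assoc, ← Matrix.mul_assoc Zᵀ, hZ, Matrix.mul_one]
  have key : A * Abarplus = Abar * Abarplus := by
    rw [hAbar, hAbarplus, Matrix.mul_assoc A P, Matrix.mul_assoc Z, ← Matrix.mul_assoc P, hPZ]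
  refine ⟨key, fun x₀ b => ?_⟩
  rw [← key, Matrix.mulVec_add, Matrix.mulVec_mulVec]
  simp only [Matrix.sub_mulVec, Matrix.one_mulVec]
  abel
end

section
/- Let M ∈ ℝ^{n×n} be symmetric positive definite. Let Z₀ ∈ ℝ^{n×p₀} satisfy Z₀ᵀ·M·Z₀ = 1, and for k = 1,…,r let Z̃ₖ ∈ ℝ^{p_{k−1}×pₖ} with Z̃ₖᵀ·Z̃ₖ = 1, and define recursively Zₖ := Z_{k−1}·Z̃ₖ. Define Pₖ := Zₖ·Zₖᵀ·M for k = 0,…,r. Then for all j ≤ k the projectors commute and absorb: Pⱼ·Pₖ = Pₖ·Pⱼ = Pₖ. -/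
open Matrix

section Absorption

variable {R m a b : Type*} [CommSemiring R] [Fintype m] [Fintype a] [DecidableEq a]

/-- If the columns of `A` are `M`-orthonormal, then `A * Aᵀ * M` fixes the columns of `A * W`. -/
theorem mul_transpose_mul_absorb_left [Fintype b] {M : Matrix m m R} {A : Matrix m a R}
    (hA : Aᵀ * M * A = 1) (W : Matrix a b R) :
    A * Aᵀ * M * (A * W * (A * W)ᵀ * M) = A * W * (A * W)ᵀ * M := by
  calc A * Aᵀ * M * (A * W * (A * W)ᵀ * M)
      = A * (Aᵀ * M * A) * (W * (A * W)ᵀ * M) := by simp only [Matrix.mul_assoc]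
    _ = A * W * (A * W)ᵀ * M := by rw [hA, Matrix.mul_one]; simp only [Matrix.mul_assoc]

/-- If the columns of `A` are `M`-orthonormal, then `A * Aᵀ * M` is absorbed on the right by the
operator built from `A * W`. -/
theorem mul_transpose_mul_absorb_right [Fintype b] {M : Matrix m m R} {A : Matrix m a R}
    (hA : Aᵀ * M * A = 1) (W : Matrix a b R) :
    A * W * (A * W)ᵀ * M * (A * Aᵀ * M) = A * W * (A * W)ᵀ * M := by
  rw [transpose_mul]
  calc A * W * (Wᵀ * Aᵀ) * M * (A * Aᵀ * M)
      = A * W * Wᵀ * (Aᵀ * M * A) * (Aᵀ * M) := by simp only [Matrix.mul_assoc]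
    _ = A * W * (Wᵀ * Aᵀ) * M := by rw [hA, Matrix.mul_one]; simp only [Matrix.mul_assoc]

/-- Multiplying by a matrix with orthonormal columns preserves `M`-orthonormality. -/
theorem transpose_mul_mul_eq_one_of_mul [DecidableEq b] {M : Matrix m m R} {A : Matrix m a R}
    {W : Matrix a b R} (hA : Aᵀ * M * A = 1) (hW : Wᵀ * W = 1) :
    (A * W)ᵀ * M * (A * W) = 1 := by
  rw [transpose_mul]
  calc Wᵀ * Aᵀ * M * (A * W) = Wᵀ * (Aᵀ * M * A) * W := by simp only [Matrix.mul_assoc]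
    _ = 1 := by rw [hA, Matrix.mul_one, hW]

end Absorption

/-- For the recursively constructed bases `Zₖ = Z_{k−1}·Z̃ₖ` (with `Z₀ᵀ·M·Z₀ = 1` and
`Z̃ₖᵀ·Z̃ₖ = 1`), the projectors `Pₖ = Zₖ·Zₖᵀ·M` commute and absorb:
`Pⱼ·Pₖ = Pₖ·Pⱼ = Pₖ` for all `j ≤ k ≤ r`. -/
theorem projector_absorption {n r : ℕ} (p : ℕ → ℕ)
    (M : Matrix (Fin n) (Fin n) ℝ) (hM : M.PosDef)
    (Z : ∀ k : ℕ, Matrix (Fin n) (Fin (p k)) ℝ)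
    (Zt : ∀ k : ℕ, Matrix (Fin (p k)) (Fin (p (k + 1))) ℝ)
    (hZ0 : (Z 0)ᵀ * M * Z 0 = 1)
    (hZt : ∀ k, k < r → (Zt k)ᵀ * Zt k = 1)
    (hrec : ∀ k, k < r → Z (k + 1) = Z k * Zt k)
    (P : ∀ k : ℕ, Matrix (Fin n) (Fin n) ℝ)
    (hP : ∀ k, k ≤ r → P k = Z k * (Z k)ᵀ * M) :
    ∀ j k, j ≤ k → k ≤ r → P j * P k = P k ∧ P k * P j = P k := by
  have orth : ∀ k, k ≤ r → (Z k)ᵀ * M * Z k = 1 := by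
    intro k
    induction k with
    | zero => exact fun _ => hZ0
    | succ k ih =>
      intro hk
      rw [hrec k hk]
      exact transpose_mul_mul_eq_one_of_mul (ih (Nat.le_of_succ_le hk)) (hZt k hk)
  have factor : ∀ j k, j ≤ k → k ≤ r → ∃ W : Matrix (Fin (p j)) (Fin (p k)) ℝ,
      Z k = Z j * W := by
    intro j k hjk
    induction k, hjk using Nat.le_induction with
    | base => exact fun _ => ⟨1, (Matrix.mul_one _).symm⟩
    | succ k _ ih =>
      intro hk
      obtain ⟨W, hW⟩ := ih (Nat.le_of_succ_le hk)
      exact ⟨W * Zt k, by rw [hrec k hk, hW, Matrix.mul_assoc]⟩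
  intro j k hjk hk
  obtain ⟨W, hW⟩ := factor j k hjk hk
  have hj := orth j (hjk.trans hk)
  rw [hP j (hjk.trans hk), hP k hk, hW]
  exact ⟨mul_transpose_mul_absorb_left hj W, mul_transpose_mul_absorb_right hj W⟩
end
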